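/- Let A be an m × n real matrix and b ∈ ℝ^m. Let C be an invertible m × m real matrix and set à = C A and b̃ = C b. Suppose there are a row index r and a column index k such that: b̃_r < 0, Ã_{r,k} < 0, Ã_{r,j} ≥ 0 for all j < k, and Ã_{r,j} = 0 for all j > k. Then every x ∈ ℝ^n with A x = b and x_j ≥ 0 for all j < k satisfies x_k > 0. In particular, the original system A x = b has no solution x with x_j ≥ 0 for all j < k and x_k < 0 and x_j = 0 for all j > k. -/

import Mathlib

open Matrix

/-- Let `C` be an invertible `m × m` matrix and `Ã = C A`,
`b̃ = C b`. If in row `r` of the transformed scheme we have `b̃ r < 0`,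
`Ã r k < 0`, `Ã r j ≥ 0` for all `j < k` and `Ã r j = 0` for all `j > k`, then
every `x` with `A x = b` and `x j ≥ 0` for all `j < k` satisfies `x k > 0`; in
particular, `A x = b` has no solution `x` with `x j ≥ 0` for all `j < k`,
`x k < 0` and `x j = 0` for all `j > k`. -/
theorem pos_of_transformed_row_structure (m n : ℕ)
    (A : Matrix (Fin m) (Fin n) ℝ) (b : Fin m → ℝ)
    (C : Matrix (Fin m) (Fin m) ℝ) (hC : IsUnit C)
    (Atil : Matrix (Fin m) (Fin n) ℝ) (btil : Fin m → ℝ)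
    (hAtil : Atil = C * A) (hbtil : btil = C *ᵥ b)
    (r : Fin m) (k : Fin n)
    (hb : btil r < 0)
    (hk : Atil r k < 0)
    (hleft : ∀ j : Fin n, j < k → 0 ≤ Atil r j)
    (hright : ∀ j : Fin n, k < j → Atil r j = 0) :
    (∀ x : Fin n → ℝ, A *ᵥ x = b → (∀ j : Fin n, j < k → 0 ≤ x j) → 0 < x k) ∧
      ¬ ∃ x : Fin n → ℝ, A *ᵥ x = b ∧ (∀ j : Fin n, j < k → 0 ≤ x j) ∧ x k < 0 ∧
        (∀ j : Fin n, k < j → x j = 0) := by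
  have hpos : ∀ x : Fin n → ℝ, A *ᵥ x = b → (∀ j : Fin n, j < k → 0 ≤ x j) → 0 < x k := by
    intro x hx hnonneg
    by_contra! hxk
    have hrow : ∑ j, Atil r j * x j = btil r := by
      have h : Atil *ᵥ x = btil := by rw [hAtil, hbtil, ← mulVec_mulVec, hx]
      exact congrFun h r
    have hsum : 0 ≤ ∑ j, Atil r j * x j := by
      refine Finset.sum_nonneg fun j _ => ?_
      rcases lt_trichotomy j k with hj | rfl | hj
      · exact mul_nonneg (hleft j hj) (hnonneg j hj)
      · exact mul_nonneg_of_nonpos_of_nonpos hk.le hxk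
      · simp [hright j hj]
    linarith
  exact ⟨hpos, fun ⟨x, hx, hnonneg, hxk, _⟩ => (hpos x hx hnonneg).not_gt hxk⟩
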